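/- Let 0 < δ < 1 be a fixed real constant and let k : ℕ → ℕ satisfy 2k(n) ≤ n and k(n) = o(√n). For each n, let G be drawn from 𝓕₂(n,⌊δn⌋) and, independently, let α be drawn from 𝓕₁(n,2k(n)). Then lim_{n→∞} Pr[G ∧ α is satisfiable] = 1, i.e., with probability tending to 1 there is a total assignment extending α that satisfies G. -/

import Mathlib

open Finset Filter

/-- A 2-clause over variables `x_0, …, x_{n-1}`: an (ordered) pair of literals on two
distinct variables, the first literal having the smaller variable index.  A literal is a
pair (variable, polarity).  There are `4 * (n choose 2)` such clauses. -/
abbrev Clause (n : ℕ) := {p : (Fin n × Bool) × (Fin n × Bool) // p.1.1 < p.2.1}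

/-- Value of a literal under a total assignment. -/
def litVal {n : ℕ} (σ : Fin n → Bool) (ℓ : Fin n × Bool) : Bool :=
  if ℓ.2 then σ ℓ.1 else !(σ ℓ.1)

/-- A total assignment satisfies a 2-clause. -/
def clauseSat {n : ℕ} (σ : Fin n → Bool) (C : Clause n) : Prop :=
  litVal σ C.val.1 = true ∨ litVal σ C.val.2 = true

/-- Probability of the event `P` under the uniform distribution on the finite type `Ω`. -/
noncomputable def pr (Ω : Type*) [Fintype Ω] (P : Ω → Prop) : ℝ :=
  (Nat.card {ω : Ω // P ω} : ℝ) / (Fintype.card Ω : ℝ)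

/-- A partial assignment to the variables `x_0, …, x_{n-1}`. -/
abbrev PAssign (n : ℕ) := Fin n → Option Bool

/-- The (two-element) set of variables of a 2-clause. -/
def vars {n : ℕ} (C : Clause n) : Finset (Fin n) := {C.val.1.1, C.val.2.1}

/-- The set of variables assigned by a partial assignment. -/
def support {n : ℕ} (α : PAssign n) : Finset (Fin n) := univ.filter (fun x => (α x).isSome)

/-- Value of a literal under a partial assignment. -/
def plitVal {n : ℕ} (α : PAssign n) (ℓ : Fin n × Bool) : Option Bool :=
  (α ℓ.1).map (fun b => if ℓ.2 then b else !b)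

/-- A partial assignment satisfies a 2-clause. -/
def pClauseSat {n : ℕ} (α : PAssign n) (C : Clause n) : Prop :=
  plitVal α C.val.1 = some true ∨ plitVal α C.val.2 = some true

/-- The set of variables of a 2-CNF (a multiset of clauses). -/
def mvars {n : ℕ} (F : Multiset (Clause n)) : Finset (Fin n) := F.toFinset.biUnion vars

/-- `α ∈ sat(H)`: `α` is an assignment to exactly the variables of `H` satisfying `H`. -/
def satAssign {n : ℕ} (H : Multiset (Clause n)) (α : PAssign n) : Prop :=
  support α = mvars H ∧ ∀ C ∈ H, pClauseSat α C

/-- `F ∧ α` is satisfiable: `α` extends to a total assignment satisfying `F`. -/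
def extendable {n : ℕ} (F : Multiset (Clause n)) (α : PAssign n) : Prop :=
  ∃ σ : Fin n → Bool, (∀ x b, α x = some b → σ x = b) ∧ ∀ C ∈ F, clauseSat σ C

/-- `θ(H,F)`: the fraction of `α ∈ sat(H)` such that `F ∧ α` is satisfiable
(`1` if `H` is unsatisfiable). -/
noncomputable def theta {n : ℕ} (H F : Multiset (Clause n)) : ℝ :=
  if Nat.card {α : PAssign n // satAssign H α} = 0 then 1
  else (Nat.card {α : PAssign n // satAssign H α ∧ extendable F α} : ℝ) /
    (Nat.card {α : PAssign n // satAssign H α} : ℝ)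

/-- Partial assignments assigning exactly `k` variables (`𝓕₁(n,k)` sample space). -/
abbrev PAk (n k : ℕ) := {α : PAssign n // (support α).card = k}

open Relation

section Implication

variable {V : Type*}

/-- The complementary literal. -/
def negLit (a : V × Bool) : V × Bool := (a.1, !a.2)

@[simp] lemma negLit_fst (a : V × Bool) : (negLit a).1 = a.1 := rfl

@[simp] lemma negLit_negLit (a : V × Bool) : negLit (negLit a) = a := by
  simp [negLit]

lemma negLit_ne (a : V × Bool) : negLit a ≠ a := by
  rcases a with ⟨v, b⟩
  simp [negLit]

lemma eq_or_eq_negLit {a b : V × Bool} (h : a.1 = b.1) : a = b ∨ a = negLit b := by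
  rcases a with ⟨v, p⟩
  rcases b with ⟨w, q⟩
  cases p <;> cases q <;> simp_all [negLit]

/-- The literal `a` is falsified by the partial assignment `α`. -/
def Falsified (α : V → Option Bool) (a : V × Bool) : Prop := α a.1 = some (!a.2)

lemma Falsified.isSome {α : V → Option Bool} {a : V × Bool} (h : Falsified α a) :
    (α a.1).isSome := by
  rw [Falsified] at h
  simp [h]

lemma Falsified.not_negLit {α : V → Option Bool} {a : V × Bool} (h : Falsified α a) :
    ¬ Falsified α (negLit a) := by
  simp only [Falsified, negLit] at *
  simp [h]

lemma falsified_or_negLit {α : V → Option Bool} {a : V × Bool} (h : (α a.1).isSome) :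
    Falsified α a ∨ Falsified α (negLit a) := by
  obtain ⟨b, hb⟩ := Option.isSome_iff_exists.mp h
  rcases a with ⟨v, p⟩
  simp only [Falsified, negLit] at *
  cases b <;> cases p <;> simp [hb]

/-- Along implications, the literal `a` leads to its own complement or to a falsified literal. -/
def Refutable (E : V × Bool → V × Bool → Prop) (α : V → Option Bool) (a : V × Bool) : Prop :=
  ∃ b, ReflTransGen E a b ∧ (b = negLit a ∨ Falsified α b)

lemma reflTransGen_negLit {E : V × Bool → V × Bool → Prop}
    (hE : ∀ a b, E a b → E (negLit b) (negLit a)) {a b : V × Bool} (h : ReflTransGen E a b) :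
    ReflTransGen E (negLit b) (negLit a) := by
  induction h with
  | refl => exact .refl
  | tail _ hbc ih => exact .head (hE _ _ hbc) ih

/-- If no variable has both literals refutable, then some total assignment extends `α` and
respects all implications. -/
lemma exists_assignment_of_not_refutable [Finite V] {E : V × Bool → V × Bool → Prop}
    (hE : ∀ a b, E a b → E (negLit b) (negLit a)) {α : V → Option Bool}
    (h : ∀ a, ¬ (Refutable E α a ∧ Refutable E α (negLit a))) :
    ∃ σ : V → Bool, (∀ x b, α x = some b → σ x = b) ∧
      ∀ a b, E a b → σ a.1 = a.2 → σ b.1 = b.2 := by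
  let good : Set (Set (V × Bool)) := {S | (∀ a, Falsified α (negLit a) → a ∈ S) ∧
    (∀ a b, E a b → a ∈ S → b ∈ S) ∧ ∀ a ∈ S, negLit a ∉ S}
  have hne : good.Nonempty := by
    refine ⟨{b | ∃ a, Falsified α (negLit a) ∧ ReflTransGen E a b},
      fun a ha => ⟨a, ha, .refl⟩, ?_, ?_⟩
    · rintro b c hbc ⟨a, ha, hab⟩
      exact ⟨a, ha, hab.tail hbc⟩
    · rintro y ⟨a, ha, hay⟩ ⟨b, hb, hby⟩
      have h1 := reflTransGen_negLit hE hby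
      rw [negLit_negLit] at h1
      exact h a ⟨⟨_, hay.trans h1, .inr hb⟩, ⟨_, .refl, .inr ha⟩⟩
  obtain ⟨S, hS⟩ := (Set.toFinite good).exists_maximal hne
  obtain ⟨⟨hα, hcl, hcons⟩, hmax⟩ := hS
  have hcl' : ∀ {a b}, ReflTransGen E a b → a ∈ S → b ∈ S := by
    intro a b hab ha
    induction hab with
    | refl => exact ha
    | tail _ hbc ih => exact hcl _ _ hbc ih
  have key : ∀ x, x ∉ S → negLit x ∉ S → Refutable E α x := by
    intro x hx hnx
    by_contra hr
    have hxy : ∀ y ∈ S, ¬ ReflTransGen E x (negLit y) := by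
      intro y hy hxy
      have h1 := reflTransGen_negLit hE hxy
      rw [negLit_negLit] at h1
      exact hnx (hcl' h1 hy)
    have hg : S ∪ {b | ReflTransGen E x b} ∈ good := by
      refine ⟨fun a ha => .inl (hα a ha), ?_, ?_⟩
      · rintro a b hab (ha | ha)
        · exact .inl (hcl _ _ hab ha)
        · exact .inr (ReflTransGen.tail ha hab)
      · rintro y (hy | hy) (hny | hny)
        · exact hcons y hy hny
        · exact hxy y hy hny
        · refine hxy _ hny ?_
          rwa [negLit_negLit]
        · have h1 := reflTransGen_negLit hE hny
          rw [negLit_negLit] at h1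
          exact hr ⟨_, ReflTransGen.trans hy h1, .inl rfl⟩
    exact hx (hmax hg Set.subset_union_left (.inr .refl))
  have htot : ∀ x, x ∈ S ∨ negLit x ∈ S := by
    intro x
    by_contra! hx
    exact h x ⟨key x hx.1 hx.2, key _ hx.2 (by rw [negLit_negLit]; exact hx.1)⟩
  classical
  have hσ : ∀ a : V × Bool, decide ((a.1, true) ∈ S) = a.2 ↔ a ∈ S := by
    rintro ⟨v, b⟩
    have h1 := htot (v, true)
    have h2 := hcons (v, true)
    cases b
    · simp only [negLit, Bool.not_true, decide_eq_false_iff_not] at *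
      tauto
    · simp only [decide_eq_true_eq]
  refine ⟨fun v => decide ((v, true) ∈ S), fun x b hxb => ?_, fun a b hab ha => ?_⟩
  · exact (hσ (x, b)).2 (hα _ (by simp [Falsified, negLit, hxb]))
  · exact (hσ b).2 (hcl _ _ hab ((hσ a).1 ha))

/-- A walk may be taken without repeated vertices. -/
lemma exists_injOn_walk {β : Type*} {E : β → β → Prop} {a b : β} (h : ReflTransGen E a b) :
    ∃ (T : ℕ) (f : ℕ → β), f 0 = a ∧ f T = b ∧ (∀ i < T, E (f i) (f (i + 1))) ∧
      ∀ i j, i < j → j ≤ T → f i ≠ f j := by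
  induction h using ReflTransGen.head_induction_on with
  | refl => exact ⟨0, fun _ => b, rfl, rfl, by simp, by omega⟩
  | @head a c hac _ ih =>
    obtain ⟨T, f, h0, hT, hf, hinj⟩ := ih
    by_cases ha : ∃ i ≤ T, f i = a
    · obtain ⟨i, hi, hia⟩ := ha
      refine ⟨T - i, fun j => f (i + j), hia, ?_, fun j hj => ?_, fun j l hjl hl => ?_⟩
      · simpa [Nat.add_sub_cancel' hi] using hT
      · exact hf (i + j) (by omega)
      · exact hinj _ _ (by omega) (by omega)
    · push Not at ha
      refine ⟨T + 1, fun j => if j = 0 then a else f (j - 1), by simp, by simpa using hT, ?_, ?_⟩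
      · intro j hj
        rcases j with _ | j
        · simpa [h0] using hac
        · simpa using hf j (by omega)
      · intro i j hij hj
        rcases j with _ | j
        · omega
        rcases i with _ | i
        · simpa using (ha j (by omega)).symm
        · simpa using hinj i j (by omega) (by omega)

/-- A refutable literal that is not falsified starts a path on distinct variables that ends
by hitting the complement of one of its own literals, or a falsified literal. -/
lemma Refutable.exists_path {E : V × Bool → V × Bool → Prop} {α : V → Option Bool}
    {x : V × Bool} (h : Refutable E α x) (hx : ¬ Falsified α x) :
    ∃ (t : ℕ) (f : ℕ → V × Bool), f 0 = x ∧ (∀ i ≤ t, E (f i) (f (i + 1))) ∧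
      (∀ i j, i < j → j ≤ t → (f i).1 ≠ (f j).1) ∧ (∀ i ≤ t, ¬ Falsified α (f i)) ∧
      (Falsified α (f (t + 1)) ∨ ∃ i ≤ t, f (t + 1) = negLit (f i)) := by
  classical
  obtain ⟨b, hb, hbx⟩ := h
  obtain ⟨T, f, h0, hT, hf, hinj⟩ := exists_injOn_walk hb
  have hex : ∃ j, j ≤ T ∧ (Falsified α (f j) ∨ ∃ i < j, f j = negLit (f i)) := by
    refine ⟨T, le_rfl, ?_⟩
    rcases hbx with hbx | hbx
    · refine .inr ⟨0, Nat.pos_of_ne_zero fun hT0 => ?_, by rw [hT, h0, hbx]⟩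
      subst hT0
      exact negLit_ne x (by rw [← hbx, ← hT, h0])
    · exact .inl (hT ▸ hbx)
  obtain ⟨hjT, hj⟩ := Nat.find_spec hex
  have hmin : ∀ i < Nat.find hex, ¬ (i ≤ T ∧ (Falsified α (f i) ∨ ∃ l < i, f i = negLit (f l))) :=
    fun i hi => Nat.find_min hex hi
  rcases hj' : Nat.find hex with _ | t
  · rw [hj'] at hj
    simp [h0, hx] at hj
  · rw [hj'] at hj hjT hmin
    refine ⟨t, f, h0, fun i hi => hf i (by omega), fun i j hij hjt he => ?_, fun i hi hF => ?_, ?_⟩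
    · rcases eq_or_eq_negLit he.symm with h1 | h1
      · exact hinj i j hij (by omega) h1.symm
      · exact hmin j (by omega) ⟨by omega, .inr ⟨i, hij, h1⟩⟩
    · exact hmin i (by omega) ⟨by omega, .inl hF⟩
    · rcases hj with hj | ⟨i, hi, hij⟩
      · exact .inl hj
      · exact .inr ⟨i, by omega, hij⟩

/-- A bicycle relative to `α`: an implication path `h 0, …, h (t + 1)` whose inner literals
`h 1, …, h t` have distinct variables, and whose two end variables are assigned by `α` or
occur among the inner ones. -/
structure IsBicycle (E : V × Bool → V × Bool → Prop) (α : V → Option Bool) (t : ℕ)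
    (h : ℕ → V × Bool) : Prop where
  edge : ∀ i ≤ t, E (h i) (h (i + 1))
  distinct : ∀ i j, 1 ≤ i → i < j → j ≤ t → (h i).1 ≠ (h j).1
  last_ne : 1 ≤ t → h (t + 1) ≠ h 1
  first_var : (α (h 0).1).isSome ∨ ∃ i, 1 ≤ i ∧ i ≤ t ∧ (h 0).1 = (h i).1
  last_var : (α (h (t + 1)).1).isSome ∨ ∃ i, 1 ≤ i ∧ i ≤ t ∧ (h (t + 1)).1 = (h i).1

lemma exists_isBicycle_of_assigned {E : V × Bool → V × Bool → Prop} {α : V → Option Bool}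
    {x : V × Bool} (hx : Falsified α (negLit x)) (h : Refutable E α x) :
    ∃ t f, IsBicycle E α t f := by
  have hx' : ¬ Falsified α x := fun hF => hF.not_negLit hx
  obtain ⟨t, f, h0, hf, hd, hF, hl⟩ := h.exists_path hx'
  have hs : (α (f 0).1).isSome := by
    rw [h0]
    exact hx.isSome
  refine ⟨t, f, hf, fun i j _ hij hj => hd i j hij hj, fun ht he => ?_, .inl hs, ?_⟩
  · rcases hl with hl | ⟨i, hi, hl⟩
    · exact hF 1 ht (he ▸ hl)
    · have h1 : (f 1).1 = (f i).1 := by rw [← he, hl, negLit_fst]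
      rcases lt_trichotomy i 1 with h2 | rfl | h2
      · exact hd i 1 h2 ht h1.symm
      · exact negLit_ne _ (hl.symm.trans he)
      · exact hd 1 i h2 hi h1
  · rcases hl with hl | ⟨i, hi, hl⟩
    · exact .inl hl.isSome
    · rcases Nat.eq_zero_or_pos i with rfl | h2
      · left
        rwa [hl, negLit_fst]
      · exact .inr ⟨i, h2, hi, by rw [hl, negLit_fst]⟩

lemma exists_isBicycle_of_unassigned {E : V × Bool → V × Bool → Prop}
    (hE : ∀ a b, E a b → E (negLit b) (negLit a)) {α : V → Option Bool}
    {x : V × Bool} (hx : ¬ Falsified α x) (hnx : ¬ Falsified α (negLit x))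
    (h : Refutable E α x) (hn : Refutable E α (negLit x)) :
    ∃ t f, IsBicycle E α t f := by
  classical
  obtain ⟨t, f, h0, hf, hd, hF, hl⟩ := h.exists_path hx
  obtain ⟨b, hb, hbx⟩ := hn
  obtain ⟨T, g, g0, gT, hg, -⟩ := exists_injOn_walk hb
  rw [negLit_negLit] at hbx
  have hT : T ≠ 0 := by
    rintro rfl
    rw [← gT, g0] at hbx
    exact hbx.elim (negLit_ne x) hnx
  have hex : ∃ s, s + 1 ≤ T ∧ ((α (g (s + 1)).1).isSome ∨
      (∃ i ≤ t, (g (s + 1)).1 = (f i).1) ∨ ∃ i ≤ s, (g (s + 1)).1 = (g i).1) := by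
    refine ⟨T - 1, by omega, ?_⟩
    rw [Nat.sub_add_cancel (by omega), gT]
    rcases hbx with hbx | hbx
    · exact .inr (.inl ⟨0, by omega, by rw [hbx, h0]⟩)
    · exact .inl hbx.isSome
  obtain ⟨hsT, hs⟩ := Nat.find_spec hex
  have hmin := fun i (hi : i < Nat.find hex) => Nat.find_min hex hi
  generalize Nat.find hex = s at hsT hs hmin
  have gα : ∀ i ≤ s, ¬ (α (g i).1).isSome := by
    intro i hi hF
    rcases i with _ | i
    · rcases falsified_or_negLit hF with h1 | h1 <;> simp_all
    · exact hmin i (by omega) ⟨by omega, .inl hF⟩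
  have gf : ∀ i ≤ s, ∀ j ≤ t, (g i).1 = (f j).1 → i = 0 ∧ j = 0 := by
    intro i hi j hj he
    rcases i with _ | i
    · refine ⟨rfl, ?_⟩
      by_contra hj0
      exact hd 0 j (by omega) hj (by rw [← he, g0, h0, negLit_fst])
    · exact (hmin i (by omega) ⟨by omega, .inr (.inl ⟨j, hj, he⟩)⟩).elim
  have gg : ∀ i j, i < j → j ≤ s → (g i).1 ≠ (g j).1 := by
    intro i j hij hj he
    obtain ⟨j, rfl⟩ := Nat.exists_eq_add_of_lt (Nat.zero_lt_of_lt hij)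
    rw [zero_add] at *
    exact hmin j (by omega) ⟨by omega, .inr (.inr ⟨i, by omega, he.symm⟩)⟩
  let w : ℕ → V × Bool := fun i => if i ≤ s then negLit (g (s + 1 - i)) else f (i - (s + 1))
  have wg : ∀ i ≤ s + 1, w i = negLit (g (s + 1 - i)) := by
    intro i hi
    rcases hi.lt_or_eq with hi | rfl
    · simp only [w, if_pos (Nat.lt_succ_iff.mp hi)]
    · simp [w, g0, h0]
  have wf : ∀ i, w (s + 1 + i) = f i := by
    intro i
    simp only [w, if_neg (show ¬ s + 1 + i ≤ s by omega), Nat.add_sub_cancel_left]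
  have wf' : ∀ i, s + 1 ≤ i → w i = f (i - (s + 1)) := by
    intro i hi
    rw [← wf, Nat.add_sub_cancel' hi]
  refine ⟨s + 1 + t, w, fun i hi => ?_, fun i j hi hij hj he => ?_, fun _ he => ?_, ?_, ?_⟩
  · rcases Nat.lt_or_ge i (s + 1) with h1 | h1
    · rw [wg i (by omega), wg (i + 1) (by omega)]
      apply hE
      have h2 := hg (s + 1 - (i + 1)) (by omega)
      rwa [show s + 1 - (i + 1) + 1 = s + 1 - i by omega] at h2
    · rw [wf' i h1, wf' (i + 1) (by omega)]
      have h2 := hf (i - (s + 1)) (by omega)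
      rwa [show i - (s + 1) + 1 = i + 1 - (s + 1) by omega] at h2
  · rcases Nat.lt_or_ge j (s + 1) with h1 | h1
    · rw [wg i (by omega), wg j (by omega), negLit_fst, negLit_fst] at he
      exact gg _ _ (by omega) (by omega) he.symm
    · rw [wf' j h1] at he
      rcases Nat.lt_or_ge i (s + 1) with h2 | h2
      · rw [wg i (by omega), negLit_fst] at he
        have := gf _ (by omega) _ (by omega) he
        omega
      · rw [wf' i h2] at he
        exact hd _ _ (by omega) (by omega) he
  · rw [add_assoc, wf, wg 1 (by omega), Nat.add_sub_cancel] at he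
    rcases hl with hl | ⟨i, hi, hl⟩
    · refine gα s le_rfl ?_
      rw [he] at hl
      exact hl.isSome
    · rw [hl] at he
      obtain ⟨rfl, rfl⟩ := gf s le_rfl i hi (by simpa using (congrArg Prod.fst he).symm)
      rw [g0, h0, negLit_negLit] at he
      exact negLit_ne x he
  · rw [wg 0 (by omega), negLit_fst, Nat.sub_zero]
    rcases hs with hs | ⟨i, hi, hs⟩ | ⟨i, hi, hs⟩
    · exact .inl hs
    · exact .inr ⟨s + 1 + i, by omega, by omega, by rw [wf, hs]⟩
    · refine .inr ⟨s + 1 - i, by omega, by omega, ?_⟩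
      rw [wg _ (by omega), negLit_fst, show s + 1 - (s + 1 - i) = i by omega, hs]
  · rw [add_assoc, wf]
    rcases hl with hl | ⟨i, hi, hl⟩
    · exact .inl hl.isSome
    · exact .inr ⟨s + 1 + i, by omega, by omega, by rw [wf, hl, negLit_fst]⟩

/-- If no total assignment extends `α` and respects the implications, there is a bicycle. -/
lemma exists_isBicycle [Finite V] {E : V × Bool → V × Bool → Prop}
    (hE : ∀ a b, E a b → E (negLit b) (negLit a)) {α : V → Option Bool}
    (h : ¬ ∃ σ : V → Bool, (∀ x b, α x = some b → σ x = b) ∧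
      ∀ a b, E a b → σ a.1 = a.2 → σ b.1 = b.2) :
    ∃ t f, IsBicycle E α t f := by
  obtain ⟨x, hx, hnx⟩ : ∃ x, Refutable E α x ∧ Refutable E α (negLit x) := by
    by_contra! hc
    exact h (exists_assignment_of_not_refutable hE fun a ha => hc a ha.1 ha.2)
  by_cases h1 : Falsified α (negLit x)
  · exact exists_isBicycle_of_assigned h1 hx
  by_cases h2 : Falsified α x
  · exact exists_isBicycle_of_assigned (by rwa [negLit_negLit]) hnx
  · exact exists_isBicycle_of_unassigned hE h2 h1 hx hnx

lemma IsBicycle.length_le [Fintype V] {E : V × Bool → V × Bool → Prop} {α : V → Option Bool}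
    {t : ℕ} {h : ℕ → V × Bool} (H : IsBicycle E α t h) : t ≤ Fintype.card V := by
  have hinj : Function.Injective fun i : Fin t => (h (i + 1)).1 := by
    intro i j hij
    by_contra hne
    rcases lt_or_gt_of_ne hne with h1 | h1
    · exact H.distinct (i + 1) (j + 1) (by omega) (by simpa using h1) (by omega) hij
    · exact H.distinct (j + 1) (i + 1) (by omega) (by simpa using h1) (by omega) hij.symm
  simpa using Fintype.card_le_of_injective _ hinj

end Implication

section Counting

variable {n : ℕ}

/-- The clauses equivalent to the implication `a → b` (at most one). -/
def edgeClauses (a b : Fin n × Bool) : Finset (Clause n) :=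
  univ.filter fun C => C.val = (negLit a, b) ∨ C.val = (b, negLit a)

/-- The implication `a → b` is given by a clause of `G`. -/
def Implies (G : Finset (Clause n)) (a b : Fin n × Bool) : Prop := ∃ C ∈ G, C ∈ edgeClauses a b

lemma eq_of_mem_edgeClauses {a b : Fin n × Bool} {C D : Clause n} (hC : C ∈ edgeClauses a b)
    (hD : D ∈ edgeClauses a b) : C = D := by
  obtain ⟨⟨c, c'⟩, hc⟩ := C
  obtain ⟨⟨d, d'⟩, hd⟩ := D
  simp only [edgeClauses, mem_filter, mem_univ, true_and, Prod.mk.injEq] at hC hD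
  rcases hC with ⟨rfl, rfl⟩ | ⟨rfl, rfl⟩ <;> rcases hD with ⟨rfl, rfl⟩ | ⟨rfl, rfl⟩
  · rfl
  · exact (lt_asymm hc hd).elim
  · exact (lt_asymm hc hd).elim
  · rfl

lemma eq_or_of_mem_edgeClauses {a b c d : Fin n × Bool} {C : Clause n}
    (h : C ∈ edgeClauses a b) (h' : C ∈ edgeClauses c d) :
    (a = c ∧ b = d) ∨ (negLit a = d ∧ b = negLit c) := by
  have hinj : ∀ {x y : Fin n × Bool}, negLit x = negLit y → x = y := fun {x y} hxy => by
    rw [← negLit_negLit x, hxy, negLit_negLit]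
  simp only [edgeClauses, mem_filter, mem_univ, true_and] at h h'
  rcases h with h | h <;> rcases h' with h' | h' <;>
    rw [h, Prod.mk.injEq] at h'
  · exact .inl ⟨hinj h'.1, h'.2⟩
  · exact .inr h'
  · exact .inr h'.symm
  · exact .inl ⟨hinj h'.2, h'.1⟩

lemma Implies.negLit {G : Finset (Clause n)} (a b : Fin n × Bool) (h : Implies G a b) :
    Implies G (negLit b) (negLit a) := by
  obtain ⟨C, hC, hab⟩ := h
  refine ⟨C, hC, ?_⟩
  simp only [edgeClauses, mem_filter, mem_univ, true_and, negLit_negLit] at *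
  exact hab.symm

lemma litVal_eq_true_iff (σ : Fin n → Bool) (a : Fin n × Bool) :
    litVal σ a = true ↔ σ a.1 = a.2 := by
  rcases a with ⟨v, b⟩
  cases b <;> simp [litVal]

lemma clauseSat_of_implies {G : Finset (Clause n)} {σ : Fin n → Bool}
    (h : ∀ a b, Implies G a b → σ a.1 = a.2 → σ b.1 = b.2) : ∀ C ∈ G, clauseSat σ C := by
  intro C hC
  have h1 := h (_root_.negLit C.val.1) C.val.2 ⟨C, hC, by simp [edgeClauses]⟩
  rw [clauseSat, litVal_eq_true_iff, litVal_eq_true_iff]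
  by_contra! hc
  refine hc.2 (h1 ?_)
  simpa [_root_.negLit, Bool.eq_not] using hc.1

/-- The clauses of the implication path `h 0, …, h (t + 1)`. -/
def pathClauses (t : ℕ) (h : ℕ → Fin n × Bool) : Finset (Clause n) :=
  (range (t + 1)).biUnion fun i => edgeClauses (h i) (h (i + 1))

lemma pathClauses_congr {t : ℕ} {h h' : ℕ → Fin n × Bool} (H : ∀ i ≤ t + 1, h i = h' i) :
    pathClauses t h = pathClauses t h' := by
  refine biUnion_congr rfl fun i hi => ?_
  rw [mem_range] at hi
  rw [H i (by omega), H (i + 1) (by omega)]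

lemma IsBicycle.pathClauses_subset {G : Finset (Clause n)} {α : PAssign n} {t : ℕ}
    {h : ℕ → Fin n × Bool} (H : IsBicycle (Implies G) α t h) : pathClauses t h ⊆ G := by
  intro C hC
  obtain ⟨i, hi, hC⟩ := mem_biUnion.mp hC
  obtain ⟨D, hD, hDi⟩ := H.edge i (by simpa [Nat.lt_succ_iff] using hi)
  rwa [eq_of_mem_edgeClauses hC hDi]

lemma IsBicycle.card_pathClauses {G : Finset (Clause n)} {α : PAssign n} {t : ℕ}
    {h : ℕ → Fin n × Bool} (H : IsBicycle (Implies G) α t h) :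
    (pathClauses t h).card = t + 1 := by
  rw [pathClauses, card_biUnion, sum_const_nat (m := 1), card_range, mul_one]
  · intro i hi
    obtain ⟨D, -, hDi⟩ := H.edge i (by simpa [Nat.lt_succ_iff] using hi)
    exact card_eq_one.mpr ⟨D, eq_singleton_iff_unique_mem.mpr
      ⟨hDi, fun C hC => eq_of_mem_edgeClauses hC hDi⟩⟩
  · have key : ∀ i j, i < j → j ≤ t →
        Disjoint (edgeClauses (h i) (h (i + 1))) (edgeClauses (h j) (h (j + 1))) := by
      intro i j hij hj
      rw [disjoint_left]
      intro C hC hC'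
      rcases eq_or_of_mem_edgeClauses hC hC' with ⟨h1, h2⟩ | ⟨-, h2⟩
      · rcases Nat.eq_zero_or_pos i with rfl | hi
        · rcases hj.lt_or_eq with hj | rfl
          · exact H.distinct 1 (j + 1) le_rfl (by omega) (by omega) (congrArg Prod.fst h2)
          · exact H.last_ne (by omega) h2.symm
        · exact H.distinct i j hi hij hj (congrArg Prod.fst h1)
      · rcases Nat.lt_or_ge (i + 1) j with h3 | h3
        · exact H.distinct (i + 1) j (by omega) h3 hj (by rw [h2, negLit_fst])
        · obtain rfl : j = i + 1 := by omega
          exact negLit_ne _ h2.symm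
    intro i hi j hj hne
    simp only [coe_range, Set.mem_Iio, Nat.lt_succ_iff] at hi hj
    rcases lt_or_gt_of_ne hne with h1 | h1
    · exact key i j h1 hj
    · exact (key j i h1 hi).symm

/-- The sequence `u, w 0, …, w (t - 1), v, v, …`. -/
def withEnds {β : Type*} {t : ℕ} (u : β) (w : Fin t → β) (v : β) (i : ℕ) : β :=
  if i = 0 then u else if hi : i - 1 < t then w ⟨i - 1, hi⟩ else v

/-- The literals whose variable is assigned by `α` or occurs in `w`. -/
def endLits {t : ℕ} (α : PAssign n) (w : Fin t → Fin n × Bool) : Finset (Fin n × Bool) :=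
  (support α ∪ univ.image fun i => (w i).1) ×ˢ univ

lemma card_endLits_le {t : ℕ} (α : PAssign n) (w : Fin t → Fin n × Bool) :
    (endLits α w).card ≤ 2 * ((support α).card + t) := by
  rw [endLits, card_product, card_univ, Fintype.card_bool, mul_comm]
  have h1 : (univ.image fun i => (w i).1).card ≤ t := by
    simpa using card_image_le (s := univ) (f := fun i => (w i).1)
  have h2 := card_union_le (support α) (univ.image fun i => (w i).1)
  omega

lemma exists_pathClauses_subset {G : Finset (Clause n)} {α : PAssign n}
    (h : ¬ ∃ σ : Fin n → Bool, (∀ x b, α x = some b → σ x = b) ∧ ∀ C ∈ G, clauseSat σ C) :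
    ∃ t ∈ range (n + 1), ∃ w : Fin t → Fin n × Bool, ∃ u ∈ endLits α w, ∃ v ∈ endLits α w,
      (pathClauses t (withEnds u w v)).card = t + 1 ∧ pathClauses t (withEnds u w v) ⊆ G := by
  obtain ⟨t, f, H⟩ := exists_isBicycle (E := Implies G) Implies.negLit (α := α)
    fun ⟨σ, h1, h2⟩ => h ⟨σ, h1, clauseSat_of_implies h2⟩
  have hend : ∀ a : Fin n × Bool, ((α a.1).isSome ∨ ∃ i, 1 ≤ i ∧ i ≤ t ∧ a.1 = (f i).1) →
      a ∈ endLits α fun i : Fin t => f (i + 1) := by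
    intro a ha
    simp only [endLits, support, mem_product, mem_union, mem_filter, mem_univ, true_and,
      mem_image, and_true]
    refine ha.imp_right ?_
    rintro ⟨i, hi, hit, he⟩
    exact ⟨⟨i - 1, by omega⟩, by simp [he, Nat.sub_add_cancel hi]⟩
  have hc : pathClauses t (withEnds (f 0) (fun i : Fin t => f (i + 1)) (f (t + 1))) =
      pathClauses t f := by
    refine pathClauses_congr fun i hi => ?_
    rcases i with _ | i
    · simp [withEnds]
    · rcases (Nat.le_of_succ_le_succ hi).lt_or_eq with h1 | rfl
      · simp [withEnds, h1]
      · simp [withEnds]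
  refine ⟨t, mem_range.mpr ?_, fun i => f (i + 1), f 0, hend _ H.first_var,
    f (t + 1), hend _ H.last_var, ?_⟩
  · have := H.length_le
    rw [Fintype.card_fin] at this
    omega
  · rw [hc]
    exact ⟨H.card_pathClauses, H.pathClauses_subset⟩

end Counting

lemma choose_sub_mul_pow_le {N m : ℕ} (hmN : m ≤ N) {r : ℕ} (hr : r ≤ m) :
    (N - r).choose (m - r) * N ^ r ≤ m ^ r * N.choose m := by
  induction r with
  | zero => simp
  | succ r ih =>
    obtain ⟨a, rfl⟩ := Nat.exists_eq_add_of_le hr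
    obtain ⟨b, rfl⟩ := Nat.exists_eq_add_of_le hmN
    have h1 := ih (by omega)
    have h2 := Nat.add_one_mul_choose_eq (a + b) a
    rw [show r + 1 + a + b - (r + 1) = a + b by omega, show r + 1 + a - (r + 1) = a by omega]
    rw [show r + 1 + a + b - r = a + b + 1 by omega, show r + 1 + a - r = a + 1 by omega] at h1
    have h3 : (a + 1) * (r + 1 + a + b) ≤ (r + 1 + a) * (a + b + 1) := by nlinarith
    refine Nat.le_of_mul_le_mul_left (c := a + b + 1) ?_ (by omega)
    calc (a + b + 1) * ((a + b).choose a * (r + 1 + a + b) ^ (r + 1))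
        = ((a + 1) * (r + 1 + a + b)) *
            ((a + b + 1).choose (a + 1) * (r + 1 + a + b) ^ r) := by
          rw [pow_succ, ← mul_assoc, h2]
          ring
      _ ≤ ((r + 1 + a) * (a + b + 1)) *
            ((r + 1 + a) ^ r * (r + 1 + a + b).choose (r + 1 + a)) := Nat.mul_le_mul h3 h1
      _ = _ := by ring

/-- A uniform `m`-subset of an `N`-set contains a given set `R` with probability at most
`(m / N) ^ R.card`. -/
lemma card_filter_subset_le {β : Type*} [Fintype β] [DecidableEq β] {m : ℕ}
    (R : Finset β) (hm : m ≤ Fintype.card β) :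
    (((powersetCard m (univ : Finset β)).filter fun G => R ⊆ G).card : ℝ) ≤
      (m / Fintype.card β : ℝ) ^ R.card * (Fintype.card β).choose m := by
  by_cases hR : R.card ≤ m
  · have h1 : ((powersetCard m (univ : Finset β)).filter fun G => R ⊆ G).card ≤
        (powersetCard (m - R.card) (univ \ R)).card := by
      refine card_le_card_of_injOn (· \ R) ?_ ?_
      · intro G hG
        simp only [coe_filter, mem_powersetCard, Set.mem_ofPred_eq] at hG
        rw [mem_coe, mem_powersetCard]
        exact ⟨sdiff_subset_sdiff hG.1.1 le_rfl, by rw [card_sdiff_of_subset hG.2, hG.1.2]⟩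
      · intro G hG G' hG' he
        simp only [coe_filter, mem_powersetCard, Set.mem_ofPred_eq] at hG hG'
        rw [← sdiff_union_of_subset hG.2, ← sdiff_union_of_subset hG'.2]
        exact congrArg (· ∪ R) he
    rw [card_powersetCard, card_sdiff_of_subset (subset_univ R), card_univ] at h1
    rcases Nat.eq_zero_or_pos (Fintype.card β) with h0 | h0
    · have hR0 : R.card = 0 := by omega
      rw [hR0, h0] at h1
      rw [hR0, h0]
      simpa using h1
    have h2 := choose_sub_mul_pow_le hm hR
    rw [div_pow, div_mul_eq_mul_div, le_div_iff₀ (by positivity)]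
    exact_mod_cast (Nat.mul_le_mul_right _ h1).trans h2
  · rw [filter_false_of_mem, card_empty]
    · simp only [Nat.cast_zero]
      positivity
    · intro G hG hRG
      rw [mem_powersetCard] at hG
      exact hR (hG.2 ▸ card_le_card hRG)

/-- The first-moment bound on the number of formulas that conflict with `α`. -/
lemma card_filter_not_extends_le {n m : ℕ} (hm : m ≤ Fintype.card (Clause n)) (α : PAssign n)
    [DecidablePred fun G : Finset (Clause n) =>
      ¬ ∃ σ : Fin n → Bool, (∀ x b, α x = some b → σ x = b) ∧ ∀ C ∈ G, clauseSat σ C] :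
    (((powersetCard m (univ : Finset (Clause n))).filter fun G =>
      ¬ ∃ σ : Fin n → Bool, (∀ x b, α x = some b → σ x = b) ∧
        ∀ C ∈ G, clauseSat σ C).card : ℝ) ≤
      (∑ t ∈ range (n + 1), (2 * n : ℝ) ^ t * (2 * ((support α).card + t)) ^ 2 *
        (m / Fintype.card (Clause n)) ^ (t + 1)) * (Fintype.card (Clause n)).choose m := by
  set N := Fintype.card (Clause n)
  let B : (t : ℕ) → (Fin t → Fin n × Bool) → (Fin n × Bool) × (Fin n × Bool) →
      Finset (Finset (Clause n)) := fun t w e =>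
    (powersetCard m univ).filter fun G => (pathClauses t (withEnds e.1 w e.2)).card = t + 1 ∧
      pathClauses t (withEnds e.1 w e.2) ⊆ G
  have hB : ∀ t w e, ((B t w e).card : ℝ) ≤ (m / N) ^ (t + 1) * N.choose m := by
    intro t w e
    by_cases hc : (pathClauses t (withEnds e.1 w e.2)).card = t + 1
    · simp only [B, hc, true_and]
      exact (card_filter_subset_le _ hm).trans_eq (by rw [hc])
    · simp only [B, hc, false_and, filter_false, card_empty, Nat.cast_zero]
      positivity
  have hsub : ((powersetCard m (univ : Finset (Clause n))).filter fun G =>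
      ¬ ∃ σ : Fin n → Bool, (∀ x b, α x = some b → σ x = b) ∧ ∀ C ∈ G, clauseSat σ C) ⊆
      (range (n + 1)).biUnion fun t => (univ : Finset (Fin t → Fin n × Bool)).biUnion fun w =>
        (endLits α w ×ˢ endLits α w).biUnion (B t w) := by
    intro G hG
    rw [mem_filter] at hG
    obtain ⟨t, ht, w, u, hu, v, hv, hR⟩ := exists_pathClauses_subset hG.2
    simp only [mem_biUnion]
    exact ⟨t, ht, w, mem_univ _, (u, v), mem_product.mpr ⟨hu, hv⟩, mem_filter.mpr ⟨hG.1, hR⟩⟩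
  calc _ ≤ ((∑ t ∈ range (n + 1), ∑ w : Fin t → Fin n × Bool,
          ∑ e ∈ endLits α w ×ˢ endLits α w, (B t w e).card : ℕ) : ℝ) :=
        Nat.cast_le.mpr <| (card_le_card hsub).trans <| card_biUnion_le.trans <|
          sum_le_sum fun t _ => card_biUnion_le.trans <| sum_le_sum fun w _ => card_biUnion_le
    _ ≤ ∑ t ∈ range (n + 1), ∑ _w : Fin t → Fin n × Bool,
          (2 * ((support α).card + t) : ℝ) ^ 2 * ((m / N) ^ (t + 1) * N.choose m) := by
        push_cast
        refine sum_le_sum fun t _ => sum_le_sum fun w _ =>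
          (sum_le_sum fun e _ => hB t w e).trans ?_
        rw [sum_const, nsmul_eq_mul, card_product, ← sq]
        gcongr
        rw [Nat.cast_pow]
        gcongr
        exact_mod_cast card_endLits_le α w
    _ = _ := by
        rw [sum_mul]
        refine sum_congr rfl fun t _ => ?_
        rw [sum_const, nsmul_eq_mul, card_univ, Fintype.card_fun, Fintype.card_prod,
          Fintype.card_fin, Fintype.card_fin, Fintype.card_bool]
        push_cast
        ring

lemma pr_le_one (Ω : Type*) [Fintype Ω] (P : Ω → Prop) : pr Ω P ≤ 1 := by
  rw [pr, ← Nat.card_eq_fintype_card]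
  exact div_le_one_of_le₀ (Nat.cast_le.mpr (Finite.card_subtype_le P)) (Nat.cast_nonneg _)

/-- If for each `b` the event fails with conditional probability at most `c`, then it has
probability at least `1 - c`. -/
lemma one_sub_le_pr_prod {A B : Type*} [Fintype A] [Fintype B] [Nonempty A] [Nonempty B]
    (P : A × B → Prop) {c : ℝ}
    (h : ∀ b, (Nat.card {a : A // ¬ P (a, b)} : ℝ) ≤ c * Fintype.card A) :
    1 - c ≤ pr (A × B) P := by
  classical
  have hpos : (0 : ℝ) < Fintype.card (A × B) := Nat.cast_pos.mpr Fintype.card_pos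
  have h1 : (Fintype.card {x : A × B // ¬ P x} : ℝ) ≤ c * Fintype.card (A × B) := by
    rw [Fintype.card_subtype, card_filter, Fintype.sum_prod_type_right]
    push_cast
    calc _ ≤ ∑ _b : B, c * (Fintype.card A : ℝ) := by
          refine sum_le_sum fun b _ => le_of_eq_of_le ?_ (h b)
          rw [Nat.card_eq_fintype_card, Fintype.card_subtype, card_filter]
          push_cast
          rfl
      _ = _ := by
          rw [sum_const, nsmul_eq_mul, card_univ, Fintype.card_prod]
          push_cast
          ring
  have h2 := Fintype.card_subtype_compl P
  have h3 := Fintype.card_subtype_le P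
  rw [pr, Nat.card_eq_fintype_card, le_div_iff₀ hpos]
  rw [h2, Nat.cast_sub h3] at h1
  linarith

lemma card_clause (n : ℕ) : Fintype.card (Clause n) = 2 * (n * (n - 1)) := by
  have e : Clause n ≃ {p : Fin n × Fin n // p.1 < p.2} × (Bool × Bool) :=
    { toFun := fun C => (⟨(C.val.1.1, C.val.2.1), C.2⟩, (C.val.1.2, C.val.2.2))
      invFun := fun x => ⟨((x.1.val.1, x.2.1), (x.1.val.2, x.2.2)), x.1.2⟩
      left_inv := fun _ => rfl
      right_inv := fun _ => rfl }
  have h : Fintype.card {p : Fin n × Fin n // p.1 < p.2} = ∑ i ∈ range n, i := by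
    rw [Fintype.card_subtype, card_filter, Fintype.sum_prod_type_right,
      ← Fin.sum_univ_eq_sum_range (fun i => i)]
    refine sum_congr rfl fun j _ => ?_
    rw [← card_filter, ← Fin.card_Iio]
    congr 1
    ext
    simp
  rw [Fintype.card_congr e, Fintype.card_prod, h, ← sum_range_id_mul_two]
  simp
  ring

lemma exists_card_support_eq {n k : ℕ} (h : k ≤ n) : Nonempty (PAk n k) := by
  obtain ⟨s, -, hs⟩ := exists_subset_card_eq (s := (univ : Finset (Fin n))) (n := k) (by simpa)
  classical
  refine ⟨fun x => if x ∈ s then some true else none, ?_⟩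
  rw [← hs, support]
  congr 1
  ext x
  by_cases hx : x ∈ s <;> simp [hx]

lemma one_sub_le_pr_extends {n m k : ℕ} (hm : m ≤ Fintype.card (Clause n)) (hk : k ≤ n) :
    1 - ∑ t ∈ range (n + 1), (2 * n : ℝ) ^ t * (2 * (k + t)) ^ 2 *
        (m / Fintype.card (Clause n)) ^ (t + 1) ≤
      pr ({s : Finset (Clause n) // s.card = m} × PAk n k)
        (fun p => ∃ σ : Fin n → Bool,
          (∀ x b, p.2.val x = some b → σ x = b) ∧ ∀ C ∈ p.1.val, clauseSat σ C) := by
  classical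
  have : Nonempty (PAk n k) := exists_card_support_eq hk
  have : Nonempty {s : Finset (Clause n) // s.card = m} := by
    obtain ⟨s, -, hs⟩ := exists_subset_card_eq (s := (univ : Finset (Clause n))) (n := m)
      (by rwa [card_univ])
    exact ⟨s, hs⟩
  refine one_sub_le_pr_prod _ fun α => ?_
  have h1 := card_filter_not_extends_le hm α.val
  rw [α.2] at h1
  rw [Fintype.card_finset_len]
  refine le_trans (Nat.cast_le.mpr ?_) h1
  rw [Nat.card_eq_fintype_card, ← card_univ]
  refine card_le_card_of_injOn (fun s => s.val.val) (fun s _ => ?_) fun s _ s' _ h => ?_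
  · simpa only [coe_filter, mem_powersetCard, Set.mem_ofPred_eq] using
      ⟨⟨subset_univ _, s.val.2⟩, s.2⟩
  · exact Subtype.ext (Subtype.ext h)

/-- The first-moment bound is of order `(K + 1) ^ 2 / n` once `2 * n * p ≤ q < 1`. -/
lemma sum_bicycle_le {q : ℝ} (hq0 : 0 ≤ q) (hq1 : q < 1) {n : ℕ} (hn : 0 < n) {K p : ℝ}
    (hK : 0 ≤ K) (hp : 0 ≤ p) (hpq : 2 * n * p ≤ q) :
    ∑ t ∈ range (n + 1), (2 * n : ℝ) ^ t * (2 * (K + t)) ^ 2 * p ^ (t + 1) ≤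
      2 * (∑' t : ℕ, ((t : ℝ) + 1) ^ 2 * q ^ t) * ((K + 1) ^ 2 / n) := by
  have hn' : (0 : ℝ) < n := Nat.cast_pos.mpr hn
  have hs : Summable fun t : ℕ => ((t : ℝ) + 1) ^ 2 * q ^ t := by
    have hq : ‖q‖ < 1 := by rwa [Real.norm_of_nonneg hq0]
    refine (((summable_pow_mul_geometric_of_norm_lt_one 2 hq).add
      ((summable_pow_mul_geometric_of_norm_lt_one 1 hq).mul_left 2)).add
      (summable_geometric_of_norm_lt_one hq)).congr fun t => ?_
    ring
  have hp' : 2 * p ≤ 1 / n := by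
    rw [le_div_iff₀ hn']
    linarith
  calc _ ≤ ∑ t ∈ range (n + 1), 2 * ((K + 1) ^ 2 / n) * (((t : ℝ) + 1) ^ 2 * q ^ t) := by
        refine sum_le_sum fun t _ => ?_
        have ht : (0 : ℝ) ≤ t := Nat.cast_nonneg t
        have h1 : K + t ≤ (K + 1) * (t + 1) := by nlinarith
        calc (2 * n : ℝ) ^ t * (2 * (K + t)) ^ 2 * p ^ (t + 1)
            = 2 * ((K + t) ^ 2 * (2 * p) * (2 * n * p) ^ t) := by
              rw [mul_pow (2 * (n : ℝ)) p t]
              ring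
          _ ≤ 2 * (((K + 1) * (t + 1)) ^ 2 * (1 / n) * q ^ t) := by gcongr
          _ = _ := by ring
    _ = 2 * ((K + 1) ^ 2 / n) * ∑ t ∈ range (n + 1), (((t : ℝ) + 1) ^ 2 * q ^ t) := by
        rw [mul_sum]
    _ ≤ 2 * ((K + 1) ^ 2 / n) * ∑' t : ℕ, ((t : ℝ) + 1) ^ 2 * q ^ t := by
        gcongr
        exact hs.sum_le_tsum _ fun t _ => by positivity
    _ = _ := by ring

lemma tendsto_add_one_sq_div {k : ℕ → ℕ}
    (hko : (fun n : ℕ => (k n : ℝ)) =o[atTop] (fun n : ℕ => Real.sqrt n)) :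
    Tendsto (fun n : ℕ => (((2 * k n : ℕ) : ℝ) + 1) ^ 2 / n) atTop (nhds 0) := by
  have hs : Tendsto (fun n : ℕ => Real.sqrt n) atTop atTop :=
    Real.tendsto_sqrt_atTop.comp tendsto_natCast_atTop_atTop
  have h := (((hko.tendsto_div_nhds_zero).const_mul 2).add
    (tendsto_const_nhds.div_atTop hs : Tendsto (fun n : ℕ => 1 / Real.sqrt n) _ _)).pow 2
  norm_num at h
  refine h.congr fun n => ?_
  rw [← one_div, mul_div_assoc', ← add_div, div_pow, Real.sq_sqrt (Nat.cast_nonneg n)]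
  push_cast
  rfl

/-- For `0 < δ < 1` and `k(n) = o(√n)` with `2k(n) ≤ n`: drawing `G ∼ 𝓕₂(n,⌊δn⌋)`
(a uniform set of `⌊δn⌋` distinct 2-clauses) and, independently, a uniform partial
assignment `α` to exactly `2k(n)` variables (`𝓕₁(n,2k(n))`), the probability that
`G ∧ α` is satisfiable tends to `1`. -/
theorem random_assignment_extends (δ : ℝ) (h0 : 0 < δ) (h1 : δ < 1) (k : ℕ → ℕ)
    (hk : ∀ n, 2 * k n ≤ n)
    (hko : (fun n : ℕ => (k n : ℝ)) =o[atTop] (fun n : ℕ => Real.sqrt n)) :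
    Tendsto (fun n : ℕ =>
      pr ({s : Finset (Clause n) // s.card = ⌊δ * n⌋₊} × PAk n (2 * k n))
        (fun p => ∃ σ : Fin n → Bool,
          (∀ x b, p.2.val x = some b → σ x = b) ∧ ∀ C ∈ p.1.val, clauseSat σ C))
      atTop (nhds 1) := by
  set q : ℝ := (1 + δ) / 2 with hq
  have hlim : Tendsto (fun n : ℕ => 1 - 2 * (∑' t : ℕ, ((t : ℝ) + 1) ^ 2 * q ^ t) *
      ((((2 * k n : ℕ) : ℝ) + 1) ^ 2 / n)) atTop (nhds 1) := by
    simpa using ((tendsto_add_one_sq_div hko).const_mul _).const_sub 1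
  refine tendsto_of_tendsto_of_tendsto_of_le_of_le' hlim tendsto_const_nhds ?_
    (Eventually.of_forall fun n => pr_le_one _ _)
  have hlarge : ∀ᶠ n : ℕ in atTop, q / (q - δ) ≤ n :=
    tendsto_natCast_atTop_atTop.eventually_ge_atTop _
  filter_upwards [hlarge, eventually_ge_atTop 2] with n hn hn2
  have hn2' : (2 : ℝ) ≤ n := by exact_mod_cast hn2
  rw [div_le_iff₀ (by linarith)] at hn
  have hm : (⌊δ * n⌋₊ : ℝ) ≤ δ * n := Nat.floor_le (by positivity)
  have hN : (Fintype.card (Clause n) : ℝ) = 2 * (n * (n - 1)) := by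
    rw [card_clause]
    push_cast [Nat.cast_sub (show 1 ≤ n by omega)]
    ring
  have hN0 : (0 : ℝ) < Fintype.card (Clause n) := by
    rw [hN]
    have : (0 : ℝ) < n - 1 := by linarith
    positivity
  have hmN : ⌊δ * n⌋₊ ≤ Fintype.card (Clause n) := by
    have : (⌊δ * n⌋₊ : ℝ) ≤ Fintype.card (Clause n) := by
      rw [hN]
      nlinarith
    exact_mod_cast this
  refine le_trans (sub_le_sub_left (sum_bicycle_le (by linarith) (by linarith) (by omega)
    (Nat.cast_nonneg _) (by positivity) ?_) 1) (one_sub_le_pr_extends hmN (hk n))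
  rw [mul_div_assoc', div_le_iff₀ hN0, hN]
  nlinarith
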